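/- Let J be a 3 × 2 real matrix such that Jᵀ J is invertible, and let M be the 2 × 3 real matrix M = [[-1, 1, 0], [-1, 0, 1]]. Then for every v ∈ ℝ³, the vector (J * (Jᵀ J)⁻¹).mulVec (M.mulVec v) equals 0 if and only if v has all equal components, i.e. v 0 = v 1 and v 0 = v 2. -/

import Mathlib

open Matrix

/-- If the Gram matrix `Jᵀ * J` is invertible, the pseudo-inverse `J * (Jᵀ * J)⁻¹` of `Jᵀ`
has trivial kernel. -/
theorem mul_gram_inv_mulVec_eq_zero_iff {m n R : Type*} [Fintype m] [Fintype n] [DecidableEq n]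
    [CommRing R] (J : Matrix m n R) [Invertible (Jᵀ * J)] (w : n → R) :
    (J * (Jᵀ * J)⁻¹).mulVec w = 0 ↔ w = 0 := by
  refine ⟨fun h => ?_, fun h => by rw [h, mulVec_zero]⟩
  have h' : Jᵀ *ᵥ ((J * (Jᵀ * J)⁻¹) *ᵥ w) = 0 := by rw [h, mulVec_zero]
  rwa [mulVec_mulVec, ← Matrix.mul_assoc, mul_inv_of_invertible, one_mulVec] at h'

/-- The per-triangle discrete gradient `(Jᵀ)† M (φ₁, φ₂, φ₃)` vanishes exactly
when the three vertex values are equal. -/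
theorem triangle_gradient_kernel (J : Matrix (Fin 3) (Fin 2) ℝ)
    [Invertible (Jᵀ * J)]
    (M : Matrix (Fin 2) (Fin 3) ℝ)
    (hM : M = !![-1, 1, 0; -1, 0, 1]) :
    ∀ v : Fin 3 → ℝ,
      (J * (Jᵀ * J)⁻¹).mulVec (M.mulVec v) = 0 ↔ v 0 = v 1 ∧ v 0 = v 2 := by
  intro v
  rw [mul_gram_inv_mulVec_eq_zero_iff, hM, funext_iff, Fin.forall_fin_two]
  simp [mulVec, dotProduct, Fin.sum_univ_three, neg_add_eq_zero]
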